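/- Let R be a commutative ring and I ⊆ R an ideal with I² = 0. Let G be a group, H ⊆ G a subgroup, and τ ∈ G with τ⁻¹Hτ = H. Let ρ : G → GL₂(R) and ρ' : H → GL₂(R) be group homomorphisms such that ρ'(h) − ρ(h) has entries in I for all h ∈ H, and set x(h) := ρ'(h)ρ(h)⁻¹ − 1. Let σ : R → R be a ring homomorphism fixing every entry of ρ(g) for all g ∈ G, and suppose A ∈ GL₂(R) satisfies: A − ρ(τ) has entries in I, and σ(ρ'(h)) = A ρ'(τ⁻¹hτ) A⁻¹ entrywise for all h ∈ H. Then, setting V := Aρ(τ)⁻¹ − 1 (a matrix with entries in I), one has for all h ∈ H the exact identity σ(x(h)) = ρ(τ) x(τ⁻¹hτ) ρ(τ)⁻¹ + V − ρ(h) V ρ(h)⁻¹; in particular the cocycles h ↦ σ(x(h)) and h ↦ ρ(τ) x(τ⁻¹hτ) ρ(τ)⁻¹ differ by the coboundary of V and define the same class in H¹(H, V_I), where V_I is the module of matrices with entries in I under conjugation by ρ. -/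

import Mathlib

/-!
STATEMENT 5: Galois-equivariance of the cocycle up to coboundary.  With
`I² = 0`, a subgroup `H ⊆ G` normalized by `τ` (`τ⁻¹Hτ = H`), homomorphisms
`ρ : G → GL₂(R)`, `ρ' : H → GL₂(R)` congruent modulo `I` on `H`,
`x(h) := ρ'(h)ρ(h)⁻¹ − 1`, a ring endomorphism `σ` of `R` fixing all entries
of all `ρ(g)`, and `A ∈ GL₂(R)` with `A ≡ ρ(τ) mod I` intertwining
`σ ∘ ρ'` with `h ↦ ρ'(τ⁻¹hτ)`, one has, for `V := Aρ(τ)⁻¹ − 1` (a matrix with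
entries in `I`), the exact identity
`σ(x(h)) = ρ(τ) x(τ⁻¹hτ) ρ(τ)⁻¹ + V − ρ(h) V ρ(h)⁻¹` for all `h ∈ H`.
-/

theorem Matrix.mul_apply_mem_left {n R : Type*} [Fintype n] [CommRing R] {I : Ideal R}
    (M : Matrix n n R) {N : Matrix n n R} (hN : ∀ i j, N i j ∈ I) (i j : n) :
    (M * N) i j ∈ I := by
  rw [Matrix.mul_apply]
  exact I.sum_mem fun k _ => I.mul_mem_left _ (hN k j)

theorem Matrix.mul_apply_mem_right {n R : Type*} [Fintype n] [CommRing R] {I : Ideal R}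
    {M : Matrix n n R} (N : Matrix n n R) (hM : ∀ i j, M i j ∈ I) (i j : n) :
    (M * N) i j ∈ I := by
  rw [Matrix.mul_apply]
  exact I.sum_mem fun k _ => I.mul_mem_right _ (hM i k)

theorem Matrix.mul_eq_zero_of_mem_of_sq_eq_bot {n R : Type*} [Fintype n] [CommRing R]
    {I : Ideal R} (hI : I ^ 2 = ⊥) {M N : Matrix n n R}
    (hM : ∀ i j, M i j ∈ I) (hN : ∀ i j, N i j ∈ I) : M * N = 0 := by
  ext i j
  rw [Matrix.mul_apply, Matrix.zero_apply]
  refine Finset.sum_eq_zero fun k _ => ?_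
  have h : M i k * N k j ∈ I ^ 2 := by
    rw [pow_two]
    exact Ideal.mul_mem_mul (hM i k) (hN k j)
  rwa [hI, Ideal.mem_bot] at h

/-- Conjugation by `A = (1 + V) T`, with `V` of square zero, expanded to first order. -/
theorem Units.conj_mul_inv_sub_one_eq {S : Type*} [Ring S] (A T P : Sˣ) (Q V X : S)
    (hV : V = A * (T⁻¹ : Sˣ) - 1) (hX : X = Q * ((T⁻¹ * P * T)⁻¹ : Sˣ) - 1)
    (hVV : V * V = 0) (hVX : V * (T * X * (T⁻¹ : Sˣ)) = 0)
    (hVP : V * (P * V * (P⁻¹ : Sˣ)) = 0)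
    (hXP : T * X * (T⁻¹ : Sˣ) * (P * V * (P⁻¹ : Sˣ)) = 0) :
    A * Q * (A⁻¹ : Sˣ) * (P⁻¹ : Sˣ) - 1 =
      T * X * (T⁻¹ : Sˣ) + V - P * V * (P⁻¹ : Sˣ) := by
  have hA : (A : S) = (1 + V) * T := by simp [hV]
  have hAinv : ((A⁻¹ : Sˣ) : S) = (T⁻¹ : Sˣ) * (1 - V) := by
    have h : (A : S) * ((T⁻¹ : Sˣ) * (1 - V)) = 1 := by
      have h1 : (A : S) * (T⁻¹ : Sˣ) = 1 + V := by simp [hV]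
      rw [← mul_assoc, h1]
      simp [mul_sub, add_mul, hVV]
    exact Units.inv_eq_of_mul_eq_one_right h
  have hQ : Q * (T⁻¹ : Sˣ) = (1 + X) * (T⁻¹ : Sˣ) * P := by
    simp [hX, mul_assoc]
  have hY : (T : S) * (1 + X) * (T⁻¹ : Sˣ) = 1 + T * X * (T⁻¹ : Sˣ) := by
    simp [mul_add, add_mul]
  have hW : (P : S) * (1 - V) * (P⁻¹ : Sˣ) = 1 - P * V * (P⁻¹ : Sˣ) := by
    simp [mul_sub, sub_mul]
  calc A * Q * (A⁻¹ : Sˣ) * (P⁻¹ : Sˣ) - 1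
      = (1 + V) * T * (Q * (T⁻¹ : Sˣ)) * (1 - V) * (P⁻¹ : Sˣ) - 1 := by
        rw [hAinv, hA]; simp only [mul_assoc]
    _ = (1 + V) * (T * (1 + X) * (T⁻¹ : Sˣ)) * (P * (1 - V) * (P⁻¹ : Sˣ)) - 1 := by
        rw [hQ]; simp only [mul_assoc]
    _ = T * X * (T⁻¹ : Sˣ) + V - P * V * (P⁻¹ : Sˣ) := by
        rw [hY, hW]
        generalize (T : S) * X * (T⁻¹ : Sˣ) = Y at *
        generalize (P : S) * V * (P⁻¹ : Sˣ) = W at *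
        simp only [mul_add, add_mul, mul_sub, one_mul, mul_one, hVX, hVP, hXP, zero_mul]
        abel

theorem stmt5 (R : Type*) [CommRing R] (I : Ideal R) (hI : I ^ 2 = ⊥)
    (G : Type*) [Group G] (H : Subgroup G) (τ : G)
    (hτ : ∀ g : G, g ∈ H ↔ τ⁻¹ * g * τ ∈ H)
    (ρ : G →* GL (Fin 2) R) (ρ' : H →* GL (Fin 2) R)
    (hcong : ∀ h : H, ∀ i j,
      ((ρ' h : Matrix (Fin 2) (Fin 2) R) - (ρ (h : G) : Matrix (Fin 2) (Fin 2) R)) i j ∈ I)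
    (x : H → Matrix (Fin 2) (Fin 2) R)
    (hx : ∀ h : H, x h =
      (ρ' h : Matrix (Fin 2) (Fin 2) R) * ((ρ (h : G))⁻¹ : GL (Fin 2) R) - 1)
    (σ : R →+* R)
    (hσ : ∀ (g : G) (i j : Fin 2),
      σ ((ρ g : Matrix (Fin 2) (Fin 2) R) i j) = (ρ g : Matrix (Fin 2) (Fin 2) R) i j)
    (A : GL (Fin 2) R)
    (hA : ∀ i j,
      ((A : Matrix (Fin 2) (Fin 2) R) - (ρ τ : Matrix (Fin 2) (Fin 2) R)) i j ∈ I)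
    (hintertwine : ∀ h : H,
      (ρ' h : Matrix (Fin 2) (Fin 2) R).map σ =
        (A : Matrix (Fin 2) (Fin 2) R) *
          (ρ' ⟨τ⁻¹ * (h : G) * τ, (hτ (h : G)).mp h.2⟩ : Matrix (Fin 2) (Fin 2) R) *
          ((A⁻¹ : GL (Fin 2) R) : Matrix (Fin 2) (Fin 2) R))
    (V : Matrix (Fin 2) (Fin 2) R)
    (hV : V = (A : Matrix (Fin 2) (Fin 2) R) * ((ρ τ)⁻¹ : GL (Fin 2) R) - 1) :
    -- V has entries in I, and σ(x(h)) = ρ(τ) x(τ⁻¹hτ) ρ(τ)⁻¹ + V − ρ(h) V ρ(h)⁻¹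
    (∀ i j, V i j ∈ I) ∧
    ∀ h : H,
      (x h).map σ =
        (ρ τ : Matrix (Fin 2) (Fin 2) R) *
            x ⟨τ⁻¹ * (h : G) * τ, (hτ (h : G)).mp h.2⟩ *
            ((ρ τ)⁻¹ : GL (Fin 2) R)
          + V - (ρ (h : G) : Matrix (Fin 2) (Fin 2) R) * V * ((ρ (h : G))⁻¹ : GL (Fin 2) R) := by
  have hVI : ∀ i j, V i j ∈ I := by
    have h : V = ((A : Matrix (Fin 2) (Fin 2) R) - (ρ τ : Matrix (Fin 2) (Fin 2) R)) *
        ((ρ τ)⁻¹ : GL (Fin 2) R) := by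
      rw [hV, sub_mul, Units.mul_inv]
    rw [h]
    exact Matrix.mul_apply_mem_right _ hA
  have hxI : ∀ h i j, x h i j ∈ I := by
    intro h
    have hh : x h = ((ρ' h : Matrix (Fin 2) (Fin 2) R) - (ρ (h : G) : Matrix (Fin 2) (Fin 2) R)) *
        ((ρ (h : G))⁻¹ : GL (Fin 2) R) := by
      rw [hx, sub_mul, Units.mul_inv]
    rw [hh]
    exact Matrix.mul_apply_mem_right _ (hcong h)
  refine ⟨hVI, fun h => ?_⟩
  have hσρ : ((((ρ (h : G))⁻¹ : GL (Fin 2) R) : Matrix (Fin 2) (Fin 2) R)).map σ =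
      ((ρ (h : G))⁻¹ : GL (Fin 2) R) := by
    rw [← map_inv]
    ext i j
    exact hσ _ i j
  have hmap : (x h).map σ = (ρ' h : Matrix (Fin 2) (Fin 2) R).map σ *
      ((ρ (h : G))⁻¹ : GL (Fin 2) R) - 1 := by
    rw [hx, Matrix.map_sub σ (map_sub σ), Matrix.map_mul, hσρ,
      Matrix.map_one σ (map_zero σ) (map_one σ)]
  have hconjX := Matrix.mul_apply_mem_right (((ρ τ)⁻¹ : GL (Fin 2) R) : Matrix (Fin 2) (Fin 2) R)
    (Matrix.mul_apply_mem_left (ρ τ : Matrix (Fin 2) (Fin 2) R)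
      (hxI ⟨τ⁻¹ * (h : G) * τ, (hτ (h : G)).mp h.2⟩))
  have hconjV := Matrix.mul_apply_mem_right
    (((ρ (h : G))⁻¹ : GL (Fin 2) R) : Matrix (Fin 2) (Fin 2) R)
    (Matrix.mul_apply_mem_left (ρ (h : G) : Matrix (Fin 2) (Fin 2) R) hVI)
  rw [hmap, hintertwine]
  refine Units.conj_mul_inv_sub_one_eq A (ρ τ) (ρ (h : G)) _ V _ hV ?_
    (Matrix.mul_eq_zero_of_mem_of_sq_eq_bot hI hVI hVI)
    (Matrix.mul_eq_zero_of_mem_of_sq_eq_bot hI hVI hconjX)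
    (Matrix.mul_eq_zero_of_mem_of_sq_eq_bot hI hVI hconjV)
    (Matrix.mul_eq_zero_of_mem_of_sq_eq_bot hI hconjX hconjV)
  rw [hx, map_mul, map_mul, map_inv]
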